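/- Let G be a finite bipartite multigraph. The linear system L_G has a nonnegative solution if and only if G contains a perfect matching; that is, 𝖫_G is nonempty if and only if there exists a perfect matching of G. -/

import Mathlib

open Finset

variable {Vp Vn E : Type*} [Fintype Vp] [Fintype Vn] [Fintype E]
  [DecidableEq Vp] [DecidableEq Vn] [DecidableEq E]

/-- `t : E → ℝ` solves the linear system `L_G`: at every positive vertex `v` the
weights of the edges incident to `v` sum to `2`, and similarly for negative vertices. -/
def SolvesLG (p : E → Vp) (q : E → Vn) (t : E → ℝ) : Prop :=
  (∀ v : Vp, ∑ e ∈ Finset.univ.filter (fun e => p e = v), t e = 2) ∧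
  (∀ v : Vn, ∑ e ∈ Finset.univ.filter (fun e => q e = v), t e = 2)

/-- The set `𝖫_G` of nonnegative solutions of `L_G`. -/
def LGset (p : E → Vp) (q : E → Vn) : Set (E → ℝ) :=
  {t | SolvesLG p q t ∧ ∀ e, 0 ≤ t e}

/-- `M` is a perfect matching of `G`: every positive vertex is the `p`-endpoint of
exactly one edge of `M`, and every negative vertex is the `q`-endpoint of exactly one
edge of `M`. -/
def IsPerfectMatching (p : E → Vp) (q : E → Vn) (M : Set E) : Prop :=
  (∀ v : Vp, ∃! e, e ∈ M ∧ p e = v) ∧ (∀ v : Vn, ∃! e, e ∈ M ∧ q e = v)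

/-- The point `t_M` associated to a perfect matching `M`: value `2` on edges of `M`
and `0` elsewhere. -/
noncomputable def tM (M : Set E) : E → ℝ := M.indicator fun _ => 2

/-- Weights summing to `2` on every fibre of `r` sum to `2 * #A` over the preimage of `A`. -/
theorem sum_filter_mem_eq_two_mul_card {V E : Type*} [Fintype E] [DecidableEq V]
    {r : E → V} {t : E → ℝ}
    (h : ∀ v : V, ∑ e ∈ Finset.univ.filter (fun e => r e = v), t e = 2) (A : Finset V) :
    ∑ e ∈ Finset.univ.filter (fun e => r e ∈ A), t e = 2 * (#A : ℝ) := by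
  rw [← Finset.sum_fiberwise_of_maps_to (t := A) (g := r) (by simp)]
  calc _ = ∑ _v ∈ A, (2 : ℝ) := Finset.sum_congr rfl fun v hv => by
        rw [← h v, Finset.filter_filter]
        congr 1
        ext e
        simp only [Finset.mem_filter, Finset.mem_univ, true_and]
        exact ⟨fun he => he.2, fun he => ⟨he ▸ hv, he⟩⟩
    _ = _ := by simp [mul_comm]

/-- The range of a section `g` of `p` is a perfect matching when `q ∘ g` is bijective. -/
theorem isPerfectMatching_range {Vp Vn E : Type*} {p : E → Vp} {q : E → Vn} {g : Vp → E}
    (hp : ∀ v, p (g v) = v) (hq : Function.Bijective (q ∘ g)) :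
    IsPerfectMatching p q (Set.range g) := by
  refine ⟨fun v => ⟨g v, ⟨⟨v, rfl⟩, hp v⟩, ?_⟩, fun v => ?_⟩
  · rintro _ ⟨⟨w, rfl⟩, rfl⟩
    rw [hp w]
  · obtain ⟨u, rfl⟩ := hq.2 v
    refine ⟨g u, ⟨⟨u, rfl⟩, rfl⟩, ?_⟩
    rintro _ ⟨⟨w, rfl⟩, hw⟩
    rw [hq.1 hw]

/-- If each vertex is the `r`-endpoint of exactly one edge of `M`, then `tM M` sums to `2`
on every fibre of `r`. -/
theorem sum_tM_eq_two {V E : Type*} [Fintype E] [DecidableEq V] {r : E → V} {M : Set E}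
    {v : V} (h : ∃! e, e ∈ M ∧ r e = v) :
    ∑ e ∈ Finset.univ.filter (fun e => r e = v), tM M e = 2 := by
  obtain ⟨e, ⟨heM, hev⟩, huniq⟩ := h
  rw [Finset.sum_eq_single_of_mem e (by simp [hev])]
  · simp [tM, heM]
  · intro e' he' hne
    exact Set.indicator_of_notMem (fun hM => hne (huniq e' ⟨hM, by simpa using he'⟩)) _

/-- If `L_G` has a nonnegative solution, then `G` satisfies Hall's condition. -/
theorem card_le_card_neighbors_of_mem_LGset {Vp Vn E : Type*} [Fintype Vn] [Fintype E]
    [DecidableEq Vp] [DecidableEq Vn] {p : E → Vp} {q : E → Vn} {t : E → ℝ}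
    (ht : t ∈ LGset p q) (A : Finset Vp) :
    #A ≤ #{w : Vn | ∃ v ∈ A, ∃ e, p e = v ∧ q e = w} := by
  obtain ⟨⟨hp, hq⟩, hnn⟩ := ht
  have hle := Finset.sum_le_sum_of_subset_of_nonneg (f := t)
    (s := {e | p e ∈ A})
    (t := {e | q e ∈ ({w : Vn | ∃ v ∈ A, ∃ e, p e = v ∧ q e = w} : Finset Vn)})
    (fun e he => by
      simp only [Finset.mem_filter, Finset.mem_univ, true_and] at he ⊢
      exact ⟨p e, he, e, rfl, rfl⟩)
    (fun e _ _ => hnn e)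
  rw [sum_filter_mem_eq_two_mul_card hp, sum_filter_mem_eq_two_mul_card hq] at hle
  exact_mod_cast le_of_mul_le_mul_left hle two_pos

/-- If `L_G` is solvable, both sides of `G` have the same number of vertices. -/
theorem SolvesLG.card_eq {Vp Vn E : Type*} [Fintype Vp] [Fintype Vn] [Fintype E]
    [DecidableEq Vp] [DecidableEq Vn] {p : E → Vp} {q : E → Vn} {t : E → ℝ}
    (ht : SolvesLG p q t) : Fintype.card Vp = Fintype.card Vn := by
  have hp := sum_filter_mem_eq_two_mul_card ht.1 Finset.univ
  have hq := sum_filter_mem_eq_two_mul_card ht.2 Finset.univ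
  simp only [Finset.mem_univ, Finset.filter_true, Finset.card_univ] at hp hq
  exact_mod_cast mul_left_cancel₀ two_ne_zero (hp.symm.trans hq)

/-- `L_G` has a nonnegative solution iff `G` contains a perfect matching. -/
theorem LGset_nonempty_iff_exists_perfectMatching (p : E → Vp) (q : E → Vn) :
    (LGset p q).Nonempty ↔ ∃ M : Set E, IsPerfectMatching p q M := by
  classical
  constructor
  · rintro ⟨t, ht⟩
    obtain ⟨f, hf, hedge⟩ := (Fintype.all_card_le_filter_rel_iff_exists_injective
      fun v w => ∃ e, p e = v ∧ q e = w).1 fun A => by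
        convert card_le_card_neighbors_of_mem_LGset ht A
    choose g hgp hgq using hedge
    obtain rfl : q ∘ g = f := funext hgq
    exact ⟨Set.range g, isPerfectMatching_range hgp
      ((Fintype.bijective_iff_injective_and_card _).2 ⟨hf, ht.1.card_eq⟩)⟩
  · rintro ⟨M, hp, hq⟩
    exact ⟨tM M, ⟨fun v => sum_tM_eq_two (hp v), fun v => sum_tM_eq_two (hq v)⟩,
      fun e => Set.indicator_nonneg (fun _ _ => zero_le_two) e⟩
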